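/- arXiv:1406.0200 — 5 statements merged into one kernel-verified Lean document; each statement's English description precedes it below -/
import Mathlib

section
/- Suppose 1 ≤ k < L and j* is an index with k + 1 < j* ≤ L such that D_{k j*} > D_{k j} for every j with k < j ≤ L and j ≠ j* (i.e., j* is the strict maximizer of the probabilistic boundary D_{k j} over all j > k). Then for every m with k < m < j*, one has D_{m k} < D_{m j*}. -/
/-- The probabilistic boundary between constellation symbols `x k` and `x j`. -/
noncomputable def probBoundary (x P : ℕ → ℝ) (h : ℝ) (k j : ℕ) : ℝ :=
  (x k + x j) / 2 - Real.log (P k / P j) / (2 * (x k - x j) * h)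

/-- The probabilistic boundary is the slope of `i ↦ (x i ^ 2 - log (P i) / h) / 2` against `x`. -/
theorem probBoundary_mul_sub {x P : ℕ → ℝ} {h : ℝ} {k j : ℕ} (hx : x k ≠ x j) (hh : h ≠ 0)
    (hk : 0 < P k) (hj : 0 < P j) :
    probBoundary x P h k j * (x k - x j) =
      (x k ^ 2 - Real.log (P k) / h) / 2 - (x j ^ 2 - Real.log (P j) / h) / 2 := by
  have hne : x k - x j ≠ 0 := sub_ne_zero.mpr hx
  rw [probBoundary, Real.log_div hk.ne' hj.ne']
  field_simp
  ring

theorem empty_decision_regions_boundary_ineq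
    (L : ℕ) (hL : 2 ≤ L) (d : ℝ) (hd : 0 < d)
    (x P : ℕ → ℝ)
    (hx : ∀ k j, 1 ≤ k → k ≤ L → 1 ≤ j → j ≤ L → x k - x j = ((j : ℝ) - (k : ℝ)) * d)
    (hP : ∀ k, 1 ≤ k → k ≤ L → 0 < P k)
    (h : ℝ) (hh : 0 < h)
    (k jstar : ℕ) (hk1 : 1 ≤ k) (hkL : k < L)
    (hjs : k + 1 < jstar) (hjsL : jstar ≤ L)
    (hmax : ∀ j, k < j → j ≤ L → j ≠ jstar →
      probBoundary x P h k j < probBoundary x P h k jstar) :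
    ∀ m, k < m → m < jstar →
      probBoundary x P h m k < probBoundary x P h m jstar := by
  intro m hkm hmj
  have hxkm : 0 < x k - x m := by
    rw [hx k m (by omega) (by omega) (by omega) (by omega)]
    exact mul_pos (sub_pos.mpr (by exact_mod_cast hkm)) hd
  have hxmj : 0 < x m - x jstar := by
    rw [hx m jstar (by omega) (by omega) (by omega) (by omega)]
    exact mul_pos (sub_pos.mpr (by exact_mod_cast hmj)) hd
  have hPk := hP k hk1 hkL.le
  have hPm := hP m (by omega) (by omega)
  have hPj := hP jstar (by omega) hjsL
  have hlt := hmax m hkm (by omega) hmj.ne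
  have hslope_km := probBoundary_mul_sub ((sub_pos.mp hxkm).ne') hh.ne' hPk hPm
  have hslope_mk := probBoundary_mul_sub ((sub_pos.mp hxkm).ne) hh.ne' hPm hPk
  have hslope_kj := probBoundary_mul_sub (by linarith : x jstar < x k).ne' hh.ne' hPk hPj
  have hslope_mj := probBoundary_mul_sub ((sub_pos.mp hxmj).ne') hh.ne' hPm hPj
  have hsymm : probBoundary x P h m k = probBoundary x P h k m :=
    mul_right_cancel₀ hxkm.ne' (by linarith)
  rw [hsymm]
  refine lt_of_mul_lt_mul_right ?_ hxmj.le
  have hmul := mul_lt_mul_of_pos_right hlt (add_pos hxkm hxmj)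
  linarith
end

section
/- For any indices with 1 ≤ k < m < j* ≤ L, if D_{k j*} > D_{k m} then D_{m k} < D_{m j*}. -/
theorem probBoundary_comm {x P : ℕ → ℝ} {h : ℝ} {k j : ℕ} :
    probBoundary x P h k j = probBoundary x P h j k := by
  have hlog : Real.log (P k / P j) = -Real.log (P j / P k) := by
    rw [← Real.log_inv, inv_div]
  have hden : 2 * (x k - x j) * h = -(2 * (x j - x k) * h) := by ring
  unfold probBoundary
  rw [hlog, hden, neg_div_neg_eq, add_comm (x k)]

theorem sub_mul_probBoundary {x P : ℕ → ℝ} {h : ℝ} {k j : ℕ} (hh : h ≠ 0)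
    (hx : x k - x j ≠ 0) (hk : P k ≠ 0) (hj : P j ≠ 0) :
    (x k - x j) * probBoundary x P h k j =
      (x k ^ 2 - x j ^ 2) / 2 - (Real.log (P k) - Real.log (P j)) / (2 * h) := by
  unfold probBoundary
  rw [Real.log_div hk hj]
  field_simp
  ring

theorem boundary_ineq_of_dominating_boundary
    (L : ℕ) (hL : 2 ≤ L) (d : ℝ) (hd : 0 < d)
    (x P : ℕ → ℝ)
    (hx : ∀ k j, 1 ≤ k → k ≤ L → 1 ≤ j → j ≤ L → x k - x j = ((j : ℝ) - (k : ℝ)) * d)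
    (hP : ∀ k, 1 ≤ k → k ≤ L → 0 < P k)
    (h : ℝ) (hh : 0 < h)
    (k m jstar : ℕ) (hk1 : 1 ≤ k) (hkm : k < m) (hmj : m < jstar) (hjL : jstar ≤ L)
    (hdom : probBoundary x P h k jstar > probBoundary x P h k m) :
    probBoundary x P h m k < probBoundary x P h m jstar := by
  have hpos : ∀ {i j : ℕ}, 1 ≤ i → i < j → j ≤ L → 0 < x i - x j := by
    intro i j hi hij hj
    rw [hx i j hi (hij.le.trans hj) (hi.trans hij.le) hj]
    exact mul_pos (sub_pos.mpr (Nat.cast_lt.mpr hij)) hd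
  have hkm_pos := hpos hk1 hkm (hmj.le.trans hjL)
  have hmj_pos := hpos (hk1.trans hkm.le) hmj hjL
  have hkj_pos := hpos hk1 (hkm.trans hmj) hjL
  have hPk := (hP k hk1 (by omega)).ne'
  have hPm := (hP m (by omega) (by omega)).ne'
  have hPj := (hP jstar (by omega) hjL).ne'
  have hkm_eq := sub_mul_probBoundary hh.ne' hkm_pos.ne' hPk hPm
  have hmj_eq := sub_mul_probBoundary hh.ne' hmj_pos.ne' hPm hPj
  have hkj_eq := sub_mul_probBoundary hh.ne' hkj_pos.ne' hPk hPj
  have hmul := mul_lt_mul_of_pos_left hdom hkj_pos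
  rw [probBoundary_comm (k := m) (j := k)]
  refine lt_of_mul_lt_mul_left ?_ hmj_pos.le
  linear_combination hmul + hkj_eq - hkm_eq - hmj_eq
end

section
/- Let 1 ≤ k < m < j* ≤ L and write m = k + f and j* = k + f + g with integers f, g ≥ 1. Then D_{k j*} > D_{k m} holds if and only if f·g·(f+g)·d²·h < log( (P_{j*}/P_m)^f · (P_k/P_m)^g ). -/
/-- Comparing two probabilistic boundaries of the same symbol: the sign of the difference is that of
the numerator over the common denominator `2 * f * (f + g) * d * h`. -/
theorem probBoundary_sub_probBoundary
    {x P : ℕ → ℝ} {d h f g : ℝ} {k m j : ℕ} (hd : 0 < d) (hh : 0 < h) (hf : 0 < f) (hg : 0 < g)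
    (hk : 0 < P k) (hm : 0 < P m) (hj : 0 < P j)
    (hxm : x k - x m = f * d) (hxj : x k - x j = (f + g) * d) :
    probBoundary x P h k j - probBoundary x P h k m =
      (f * (Real.log (P j) - Real.log (P m)) + g * (Real.log (P k) - Real.log (P m)) -
        f * g * (f + g) * d ^ 2 * h) / (2 * f * (f + g) * d * h) := by
  have hfg : f + g ≠ 0 := by positivity
  unfold probBoundary
  rw [hxm, hxj, Real.log_div hk.ne' hm.ne', Real.log_div hk.ne' hj.ne',
    show x m = x k - f * d by linarith, show x j = x k - (f + g) * d by linarith]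
  field_simp
  ring

theorem dominating_boundary_iff_log_inequality
    (L : ℕ) (hL : 2 ≤ L) (d : ℝ) (hd : 0 < d)
    (x P : ℕ → ℝ)
    (hx : ∀ k j, 1 ≤ k → k ≤ L → 1 ≤ j → j ≤ L → x k - x j = ((j : ℝ) - (k : ℝ)) * d)
    (hP : ∀ k, 1 ≤ k → k ≤ L → 0 < P k)
    (h : ℝ) (hh : 0 < h)
    (k m jstar f g : ℕ) (hk1 : 1 ≤ k) (hf : 1 ≤ f) (hg : 1 ≤ g)
    (hm : m = k + f) (hjstar : jstar = k + f + g) (hjL : jstar ≤ L) :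
    probBoundary x P h k jstar > probBoundary x P h k m ↔
      (f : ℝ) * g * ((f : ℝ) + g) * d ^ 2 * h <
        Real.log ((P jstar / P m) ^ f * (P k / P m) ^ g) := by
  subst hm hjstar
  have hk := hP k hk1 (by lia)
  have hm := hP (k + f) (by lia) (by lia)
  have hj := hP (k + f + g) (by lia) hjL
  have hxm : x k - x (k + f) = (f : ℝ) * d := by
    rw [hx k (k + f) hk1 (by lia) (by lia) (by lia)]
    push_cast
    ring
  have hxj : x k - x (k + f + g) = ((f : ℝ) + g) * d := by
    rw [hx k (k + f + g) hk1 (by lia) (by lia) hjL]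
    push_cast
    ring
  have hf' : (0 : ℝ) < f := by exact_mod_cast hf
  have hg' : (0 : ℝ) < g := by exact_mod_cast hg
  rw [gt_iff_lt, ← sub_pos, probBoundary_sub_probBoundary hd hh hf' hg' hk hm hj hxm hxj,
    div_pos_iff_of_pos_right (by positivity), sub_pos,
    Real.log_mul (by positivity) (by positivity), Real.log_pow, Real.log_pow,
    Real.log_div hj.ne' hm.ne', Real.log_div hk.ne' hm.ne']
end

section
/- Let 1 ≤ k < m < j* ≤ L and write m = k + f and j* = k + f + g with integers f, g ≥ 1. If f·g·(f+g)·d²·h < log( (P_k/P_m)^g · (P_{j*}/P_m)^f ), then D_{m k} < D_{m j*}. -/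
theorem boundary_ineq_of_log_inequality
    (L : ℕ) (hL : 2 ≤ L) (d : ℝ) (hd : 0 < d)
    (x P : ℕ → ℝ)
    (hx : ∀ k j, 1 ≤ k → k ≤ L → 1 ≤ j → j ≤ L → x k - x j = ((j : ℝ) - (k : ℝ)) * d)
    (hP : ∀ k, 1 ≤ k → k ≤ L → 0 < P k)
    (h : ℝ) (hh : 0 < h)
    (k m jstar f g : ℕ) (hk1 : 1 ≤ k) (hf : 1 ≤ f) (hg : 1 ≤ g)
    (hm : m = k + f) (hjstar : jstar = k + f + g) (hjL : jstar ≤ L)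
    (hlog : (f : ℝ) * g * ((f : ℝ) + g) * d ^ 2 * h <
      Real.log ((P k / P m) ^ g * (P jstar / P m) ^ f)) :
    probBoundary x P h m k < probBoundary x P h m jstar := by
  have hPk : 0 < P k := hP k hk1 (by omega)
  have hPm : 0 < P m := hP m (by omega) (by omega)
  have hPj : 0 < P jstar := hP jstar (by omega) hjL
  have hfpos : (0 : ℝ) < f := by exact_mod_cast hf
  have hgpos : (0 : ℝ) < g := by exact_mod_cast hg
  have hxk : x m - x k = -(f * d) := by
    rw [hx m k (by omega) (by omega) hk1 (by omega), hm]
    push_cast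
    ring
  have hxj : x m - x jstar = g * d := by
    rw [hx m jstar (by omega) (by omega) (by omega) hjL, hm, hjstar]
    push_cast
    ring
  rw [Real.log_mul (by positivity) (by positivity), Real.log_pow, Real.log_pow,
    Real.log_div hPk.ne' hPm.ne', Real.log_div hPj.ne' hPm.ne'] at hlog
  have hdiff : probBoundary x P h m jstar - probBoundary x P h m k =
      (g * (Real.log (P k) - Real.log (P m)) + f * (Real.log (P jstar) - Real.log (P m)) -
        f * g * (f + g) * d ^ 2 * h) / (2 * f * g * d * h) := by
    unfold probBoundary
    rw [Real.log_div hPm.ne' hPk.ne', Real.log_div hPm.ne' hPj.ne', hxk, hxj,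
      show x k = x m + f * d by linarith, show x jstar = x m - g * d by linarith]
    field_simp
    ring
  rw [← sub_pos, hdiff]
  exact div_pos (sub_pos.mpr hlog) (by positivity)
end

section
/- For every interior index k with 1 < k < L and every real Z, the symbol x_k is the strict maximizer of the MAP slicer metric (i.e., μ_k(Z) > μ_j(Z) for all j ≠ k) if and only if max_{j : k < j ≤ L} D_{k j} < Z < min_{j : 1 ≤ j < k} D_{k j}. -/
/-- The MAP slicer metric of symbol `x j` at decision statistic `Z`. -/
noncomputable def slicerMetric (x P : ℕ → ℝ) (h : ℝ) (j : ℕ) (Z : ℝ) : ℝ :=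
  Real.log (P j) / h - (Z - x j) ^ 2

/-- The metric difference of two symbols is proportional to the distance from their boundary. -/
theorem slicerMetric_sub_slicerMetric {x P : ℕ → ℝ} {h : ℝ} {k j : ℕ} (hh : h ≠ 0)
    (hk : P k ≠ 0) (hj : P j ≠ 0) (hkj : x k - x j ≠ 0) (Z : ℝ) :
    slicerMetric x P h k Z - slicerMetric x P h j Z =
      2 * (x k - x j) * (Z - probBoundary x P h k j) := by
  unfold slicerMetric probBoundary
  rw [Real.log_div hk hj]
  field_simp
  ring

theorem slicerMetric_lt_iff_probBoundary_lt {x P : ℕ → ℝ} {h : ℝ} {k j : ℕ} (hh : h ≠ 0)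
    (hk : P k ≠ 0) (hj : P j ≠ 0) (hkj : x j < x k) (Z : ℝ) :
    slicerMetric x P h j Z < slicerMetric x P h k Z ↔ probBoundary x P h k j < Z := by
  have hpos : 0 < 2 * (x k - x j) := by linarith
  rw [← sub_pos, slicerMetric_sub_slicerMetric hh hk hj (sub_pos.2 hkj).ne',
    mul_pos_iff_of_pos_left hpos, sub_pos]

theorem slicerMetric_lt_iff_lt_probBoundary {x P : ℕ → ℝ} {h : ℝ} {k j : ℕ} (hh : h ≠ 0)
    (hk : P k ≠ 0) (hj : P j ≠ 0) (hkj : x k < x j) (Z : ℝ) :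
    slicerMetric x P h j Z < slicerMetric x P h k Z ↔ Z < probBoundary x P h k j := by
  have hneg : 2 * (x k - x j) < 0 := by linarith
  rw [← sub_pos, slicerMetric_sub_slicerMetric hh hk hj (sub_neg.2 hkj).ne,
    ← neg_mul_neg, mul_pos_iff_of_pos_left (neg_pos.2 hneg), neg_pos, sub_neg]

theorem interior_decision_region_iff
    (L : ℕ) (hL : 2 ≤ L) (d : ℝ) (hd : 0 < d)
    (x P : ℕ → ℝ)
    (hx : ∀ k j, 1 ≤ k → k ≤ L → 1 ≤ j → j ≤ L → x k - x j = ((j : ℝ) - (k : ℝ)) * d)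
    (hP : ∀ k, 1 ≤ k → k ≤ L → 0 < P k)
    (h : ℝ) (hh : 0 < h)
    (k : ℕ) (hk1 : 1 < k) (hkL : k < L) (Z : ℝ) :
    (∀ j, 1 ≤ j → j ≤ L → j ≠ k → slicerMetric x P h k Z > slicerMetric x P h j Z) ↔
      ((∀ j, k < j → j ≤ L → probBoundary x P h k j < Z) ∧
       (∀ j, 1 ≤ j → j < k → Z < probBoundary x P h k j)) := by
  have hPk := (hP k hk1.le hkL.le).ne'
  have upper : ∀ j, k < j → j ≤ L →
      (slicerMetric x P h j Z < slicerMetric x P h k Z ↔ probBoundary x P h k j < Z) := by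
    intro j hkj hjL
    have hj1 : 1 ≤ j := (hk1.trans hkj).le
    refine slicerMetric_lt_iff_probBoundary_lt hh.ne' hPk (hP j hj1 hjL).ne' ?_ Z
    rw [← sub_pos, hx k j hk1.le hkL.le hj1 hjL]
    exact mul_pos (sub_pos.2 (Nat.cast_lt.2 hkj)) hd
  have lower : ∀ j, 1 ≤ j → j < k →
      (slicerMetric x P h j Z < slicerMetric x P h k Z ↔ Z < probBoundary x P h k j) := by
    intro j hj1 hjk
    have hjL : j ≤ L := (hjk.trans hkL).le
    refine slicerMetric_lt_iff_lt_probBoundary hh.ne' hPk (hP j hj1 hjL).ne' ?_ Z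
    rw [← sub_neg, hx k j hk1.le hkL.le hj1 hjL]
    exact mul_neg_of_neg_of_pos (sub_neg.2 (Nat.cast_lt.2 hjk)) hd
  constructor
  · intro hmax
    exact ⟨fun j hkj hjL => (upper j hkj hjL).1 (hmax j (hk1.trans hkj).le hjL hkj.ne'),
      fun j hj1 hjk => (lower j hj1 hjk).1 (hmax j hj1 (hjk.trans hkL).le hjk.ne)⟩
  · rintro ⟨hlo, hhi⟩ j hj1 hjL hne
    rcases hne.lt_or_gt with hjk | hkj
    · exact (lower j hj1 hjk).2 (hhi j hj1 hjk)
    · exact (upper j hkj hjL).2 (hlo j hkj hjL)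
end
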